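/- Let V be an open neighborhood of 0 in ℂ^{n−1} × ℂ and let F = (f̃, g) : V → ℂ^{N−1} × ℂ be holomorphic with Im g(z,w) = ‖f̃(z,w)‖² whenever (z,w) ∈ V and Im w = ‖z‖² (i.e., F maps ∂ℍ^n ∩ V into ∂ℍ^N). Define H(z, u, t) := Im g(z, u + i(t + ‖z‖²)) − ‖f̃(z, u + i(t + ‖z‖²))‖² for (z, u, t) ∈ ℂ^{n−1} × ℝ × ℝ near 0. Then, for (z,u) near 0 and with all derivatives of f̃ and g evaluated at the boundary point (z, u + i‖z‖²): H(z,u,t) = P₁·t + P₂·t² + P₃·t³ + o(t³) as t → 0, where P₁ = g_w − 2i·(f̃_w · conj(f̃)), P₂ = −2‖f̃_w‖², and P₃ = (1/3)·(−(1/2)·g_{www} + 3i·(f̃_w · conj(f̃_{ww})) + i·(f̃_{www} · conj(f̃))). Here the subscript w denotes ∂/∂w (iterated for www, etc.), and a·b = ∑_j a_j b_j is the bilinear dot product on ℂ^{N−1}. -/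

import Mathlib

open Asymptotics

/-- The partial derivative `∂/∂w` of a holomorphic map defined on `ℂ^m × ℂ` (derivative
in the direction of the last, `w`, coordinate). -/
noncomputable def DW {X Y : Type*} [NormedAddCommGroup X] [NormedSpace ℂ X]
    [NormedAddCommGroup Y] [NormedSpace ℂ Y] (f : X × ℂ → Y) (p : X × ℂ) : Y :=
  fderiv ℂ f p (0, 1)

open Filter Topology Metric MeasureTheory

section aux
variable {X Y : Type*} [NormedAddCommGroup X] [NormedSpace ℂ X]
    [NormedAddCommGroup Y] [NormedSpace ℂ Y]

/-- Derivative along the `w`-slice. -/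
lemma slice_hasDerivAt {h : X × ℂ → Y} {p : X × ℂ} {s : ℂ}
    (hd : DifferentiableAt ℂ h (p + (0, s))) :
    HasDerivAt (fun s : ℂ => h (p + (0, s))) (DW h (p + (0, s))) s := by
  have h1 : HasDerivAt (fun s : ℂ => p + ((0 : X), s)) ((0 : X), (1 : ℂ)) s :=
    ((hasDerivAt_const s (0 : X)).prodMk (hasDerivAt_id s)).const_add p
  exact hd.hasFDerivAt.comp_hasDerivAt s h1

/-- Holomorphic maps are locally Lipschitz. -/
lemma exists_lipschitz {V : Set (X × ℂ)} (hV : IsOpen V) {h : X × ℂ → Y}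
    (hh : DifferentiableOn ℂ h V) {p : X × ℂ} (hp : p ∈ V) :
    ∃ r > 0, ball p (2 * r) ⊆ V ∧ ∃ K, LipschitzOnWith K h (ball p (2 * r)) := by
  have hc : ContinuousAt h p := (hh.continuousOn.continuousAt (hV.mem_nhds hp))
  have h1 : ∀ᶠ x in 𝓝 p, dist (h x) (h p) < 1 := hc (ball_mem_nhds _ one_pos)
  obtain ⟨δ, hδ, hb⟩ := eventually_nhds_iff_ball.mp (h1.and (hV.mem_nhds hp))
  refine ⟨δ / 4, by positivity, fun x hx => (hb x (ball_subset_ball (by linarith) hx)).2,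
    (2 / (δ / 2)).toNNReal, ?_⟩
  refine (convex_ball p _).lipschitzOnWith_of_nnnorm_fderiv_le (𝕜 := ℂ) (fun x hx => ?_)
    (fun x hx => ?_)
  · exact hh.differentiableAt (hV.mem_nhds (hb x (ball_subset_ball (by linarith) hx)).2)
  · have hsub : ball x (δ / 2) ⊆ ball p δ := by
      apply ball_subset_ball'
      have := mem_ball.mp hx
      linarith
    have hxp := (hb x (ball_subset_ball (by linarith) hx)).1
    rw [← NNReal.coe_le_coe, coe_nnnorm, Real.coe_toNNReal _ (by positivity)]
    refine Complex.norm_fderiv_le_div_of_mapsTo_ball (R₂ := 2)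
      (hh.mono fun y hy => (hb y (hsub hy)).2) (fun y hy => ?_) (by positivity)
    have hyp := (hb y (hsub hy)).1
    have := dist_triangle_right (h y) (h x) (h p)
    simp only [mem_closedBall]; linarith

/-- The `w`-derivative of a holomorphic map is holomorphic. -/
lemma DW_differentiableOn [FiniteDimensional ℂ X] [FiniteDimensional ℂ Y]
    {V : Set (X × ℂ)} (hV : IsOpen V) {h : X × ℂ → Y}
    (hh : DifferentiableOn ℂ h V) : DifferentiableOn ℂ (DW h) V := by
  intro p hp
  apply DifferentiableAt.differentiableWithinAt
  have : CompleteSpace Y := FiniteDimensional.complete ℂ Y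
  obtain ⟨r, hr, hsub, K, hK⟩ := exists_lipschitz hV hh hp
  have hmem : ∀ x ∈ ball p r, ∀ s : ℂ, ‖s‖ ≤ r → x + (0, s) ∈ ball p (2 * r) := by
    intro x hx s hs
    rw [mem_ball, dist_eq_norm] at *
    have e : x + (0, s) - p = (x - p) + ((0 : X), s) := by abel
    have h2 : ‖((0 : X), s)‖ ≤ r := by simp [Prod.norm_def, hs]
    rw [e]
    have := norm_add_le (x - p) ((0 : X), s)
    linarith
  have hpp : p ∈ ball p r := mem_ball_self hr
  let c : ℝ → ℂ := fun θ => deriv (circleMap 0 r) θ * (1 / (circleMap 0 r θ) ^ 2)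
  have hcc : Continuous c := by
    have h0 : ∀ θ, circleMap 0 r θ ≠ 0 := fun θ => circleMap_ne_center hr.ne'
    simp only [c, deriv_circleMap]
    have := continuous_circleMap 0 r
    exact (this.mul continuous_const).mul
      (continuous_const.div (this.pow 2) (fun θ => pow_ne_zero 2 (h0 θ)))
  have hcn : ∀ θ, ‖circleMap 0 r θ‖ ≤ r := fun θ => by simp [abs_of_pos hr]
  let F : X × ℂ → ℝ → Y := fun x θ => c θ • h (x + (0, circleMap 0 r θ))
  let μ : Measure ℝ := volume.restrict (Set.Ioc 0 (2 * Real.pi))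
  have hFc : ∀ x ∈ ball p r, Continuous (F x) := by
    intro x hx
    apply hcc.smul
    exact hK.continuousOn.comp_continuous
      (continuous_const.add (continuous_const.prodMk (continuous_circleMap 0 r)))
      (fun θ => hmem x hx _ (hcn θ))
  have key : ∀ x ∈ ball p r, DW h x = (2 * Real.pi * Complex.I : ℂ)⁻¹ • ∫ θ, F x θ ∂μ := by
    intro x hx
    have hd : ∀ s ∈ closedBall (0 : ℂ) r, DifferentiableAt ℂ h (x + (0, s)) := fun s hs =>
      hh.differentiableAt (hV.mem_nhds (hsub (hmem x hx s (by simpa using hs))))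
    have h1 := DifferentiableOn.deriv_eq_smul_circleIntegral (f := fun s : ℂ => h (x + (0, s)))
      (c := 0) hr
      (fun s hs => (slice_hasDerivAt (hd s hs)).differentiableAt.differentiableWithinAt)
    rw [(slice_hasDerivAt (hd 0 (by simp [hr.le]))).deriv] at h1
    have e0 : x + ((0 : X), (0 : ℂ)) = x := by ext <;> simp
    rw [e0] at h1
    have hne : (2 * Real.pi * Complex.I : ℂ) ≠ 0 := by simp [Real.pi_ne_zero]
    rw [eq_inv_smul_iff₀ hne, ← h1, circleIntegral,
      intervalIntegral.integral_of_le (by positivity)]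
    simp only [F, c, μ, sub_zero, smul_smul]
  have main : DifferentiableAt ℂ (fun x => ∫ θ, F x θ ∂μ) p := by
    let : MeasurableSpace (X × ℂ) := borel _
    have : BorelSpace (X × ℂ) := ⟨rfl⟩
    have : FiniteDimensional ℂ (X × ℂ →L[ℂ] Y) := inferInstance
    have : ProperSpace (X × ℂ →L[ℂ] Y) := FiniteDimensional.proper ℂ _
    refine (hasFDerivAt_integral_of_dominated_loc_of_lip (𝕜 := ℂ) (μ := μ) (F := F)
      (F' := fun θ => c θ • fderiv ℂ h (p + (0, circleMap 0 r θ)))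
      (bound := fun θ => ‖c θ‖ * K)
      (ball_mem_nhds p hr) ?_ ?_ ?_ ?_ ?_ ?_).2.differentiableAt
    · filter_upwards [ball_mem_nhds p hr] with x hx
      exact (hFc x hx).aestronglyMeasurable
    · exact (hFc p hpp).integrableOn_Ioc
    · apply hcc.aestronglyMeasurable.smul
      have hm : Measurable (fun θ : ℝ => p + ((0 : X), circleMap 0 r θ)) :=
        (continuous_const.add
          (continuous_const.prodMk (continuous_circleMap 0 r))).measurable
      exact ((measurable_fderiv ℂ h).comp hm).aestronglyMeasurable
    · refine Eventually.of_forall fun θ => ?_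
      refine LipschitzOnWith.of_dist_le_mul fun x hx y hy => ?_
      have h1 := hK.dist_le_mul _ (hmem x hx _ (hcn θ)) _ (hmem y hy _ (hcn θ))
      rw [dist_add_right] at h1
      simp only [F, dist_smul₀, Real.coe_nnabs]
      rw [abs_of_nonneg (by positivity), mul_assoc]
      gcongr
    · exact (hcc.norm.mul continuous_const).integrableOn_Ioc
    · refine Eventually.of_forall fun θ => ?_
      have hd : DifferentiableAt ℂ h (p + (0, circleMap 0 r θ)) :=
        hh.differentiableAt (hV.mem_nhds (hsub (hmem p hpp _ (hcn θ))))
      have hd2 : HasFDerivAt (fun x => h (x + (0, circleMap 0 r θ)))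
          (fderiv ℂ h (p + (0, circleMap 0 r θ))) p :=
        (hasFDerivAt_comp_add_right _).mpr hd.hasFDerivAt
      exact hd2.const_smul (c θ)
  refine (main.const_smul ((2 * Real.pi * Complex.I : ℂ)⁻¹)).congr_of_eventuallyEq ?_
  filter_upwards [ball_mem_nhds p hr] with x hx using key x hx

/-- Integrating a little-o estimate. -/
lemma isLittleO_step {φ φ' : ℂ → Y} (n : ℕ) (hd : ∀ᶠ s in 𝓝 0, HasDerivAt φ (φ' s) s)
    (h0 : φ 0 = 0) (ho : φ' =o[𝓝 0] fun s : ℂ => s ^ n) :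
    φ =o[𝓝 0] fun s : ℂ => s ^ (n + 1) := by
  rw [isLittleO_iff] at ho ⊢
  intro c hc
  obtain ⟨δ, hδ, hb⟩ := eventually_nhds_iff_ball.mp (hd.and (ho hc))
  filter_upwards [ball_mem_nhds (0 : ℂ) hδ] with s hs
  have hs' : ‖s‖ < δ := by simpa using hs
  have hsub : ∀ x ∈ closedBall (0 : ℂ) ‖s‖, x ∈ ball (0 : ℂ) δ := fun x hx => by
    have : ‖x‖ ≤ ‖s‖ := by simpa using hx
    simpa using this.trans_lt hs'
  have := (convex_closedBall (0 : ℂ) ‖s‖).norm_image_sub_le_of_norm_hasDerivWithin_le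
    (f := φ) (f' := φ') (C := c * ‖s‖ ^ n)
    (fun x hx => (hb x (hsub x hx)).1.hasDerivWithinAt)
    (fun x hx => by
      have h1 := (hb x (hsub x hx)).2
      have h2 : ‖x‖ ≤ ‖s‖ := by simpa using hx
      rw [norm_pow] at h1
      refine h1.trans ?_
      gcongr)
    (show (0 : ℂ) ∈ closedBall (0 : ℂ) ‖s‖ by simp)
    (show s ∈ closedBall (0 : ℂ) ‖s‖ by simp)
  rw [h0] at this
  simpa [pow_succ, mul_assoc] using this

lemma taylor3 [FiniteDimensional ℂ X] [FiniteDimensional ℂ Y]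
    {V : Set (X × ℂ)} (hV : IsOpen V) {h : X × ℂ → Y}
    (hh : DifferentiableOn ℂ h V) {q : X × ℂ} (hq : q ∈ V) :
    (fun s : ℂ => h (q + (0, s)) - (h q + s • DW h q + (s ^ 2 / 2) • DW (DW h) q
      + (s ^ 3 / 6) • DW (DW (DW h)) q)) =o[𝓝 0] fun s : ℂ => s ^ 3 := by
  have h1 := DW_differentiableOn hV hh
  have h2 := DW_differentiableOn hV h1
  have e0 : q + ((0 : X), (0 : ℂ)) = q := by ext <;> simp
  have hev : ∀ᶠ s : ℂ in 𝓝 0, q + (0, s) ∈ V := by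
    have : Continuous (fun s : ℂ => q + ((0 : X), s)) := by fun_prop
    exact this.continuousAt (by rw [e0]; exact hV.mem_nhds hq)
  have D : ∀ {k : X × ℂ → Y}, DifferentiableOn ℂ k V → ∀ s : ℂ, q + (0, s) ∈ V →
      HasDerivAt (fun s : ℂ => k (q + (0, s))) (DW k (q + (0, s))) s := fun hk s hs =>
    slice_hasDerivAt (hk.differentiableAt (hV.mem_nhds hs))
  have s1 : (fun s : ℂ => DW (DW h) (q + (0, s)) - (DW (DW h) q + s • DW (DW (DW h)) q))
      =o[𝓝 0] fun s : ℂ => s ^ 1 := by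
    have := (D h2 0 (by rwa [e0])).isLittleO
    simp only [e0, sub_zero, pow_one] at this ⊢
    refine this.congr_left fun s => ?_
    abel
  have s2 : (fun s : ℂ => DW h (q + (0, s)) - (DW h q + s • DW (DW h) q
      + (s ^ 2 / 2) • DW (DW (DW h)) q)) =o[𝓝 0] fun s : ℂ => s ^ 2 := by
    refine isLittleO_step 1 ?_ (by simp [e0]) s1
    filter_upwards [hev] with s hs
    have a1 : HasDerivAt (fun s : ℂ => s ^ 2 / 2) s s := by
      exact ((hasDerivAt_pow 2 s).div_const 2).congr_deriv (by norm_num)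
    have a2 := (((hasDerivAt_id s).smul_const (DW (DW h) q)).const_add (DW h q)).add
      (a1.smul_const (DW (DW (DW h)) q))
    exact ((D h1 s hs).sub a2).congr_deriv (by rw [one_smul])
  refine isLittleO_step 2 ?_ (by simp [e0]) s2
  filter_upwards [hev] with s hs
  have a1 : HasDerivAt (fun s : ℂ => s ^ 2 / 2) s s := by
    exact ((hasDerivAt_pow 2 s).div_const 2).congr_deriv (by norm_num)
  have a0 : HasDerivAt (fun s : ℂ => s ^ 3 / 6) (s ^ 2 / 2) s := by
    exact ((hasDerivAt_pow 3 s).div_const 6).congr_deriv (by norm_num; ring)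
  have a2 := ((((hasDerivAt_id s).smul_const (DW h q)).const_add (h q)).add
      (a1.smul_const (DW (DW h) q))).add (a0.smul_const (DW (DW (DW h)) q))
  exact ((D hh s hs).sub a2).congr_deriv (by rw [one_smul])

end aux
section aux2
variable {E : Type*} [NormedAddCommGroup E] [InnerProductSpace ℂ E]

/-- `t⁴·(continuous)` is `o(t³)`. -/
lemma rem_isLittleO {R : ℝ → ℂ} (hR : Continuous R) :
    (fun t : ℝ => (t : ℂ) ^ 4 * R t) =o[𝓝 0] fun t : ℝ => t ^ 3 := by
  have h1 : (fun t : ℝ => (t : ℂ) * R t) =o[𝓝 0] fun _ : ℝ => (1 : ℝ) := by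
    rw [isLittleO_one_iff]
    have : Continuous (fun t : ℝ => (t : ℂ) * R t) := by fun_prop
    simpa using this.tendsto 0
  have h2 : (fun t : ℝ => (t : ℂ) ^ 3) =O[𝓝 0] fun t : ℝ => t ^ 3 :=
    IsBigO.of_bound 1 (Eventually.of_forall fun t => by simp)
  refine (h2.mul_isLittleO h1).congr (fun t => by ring) (fun t => by ring)

/-- Uniqueness of a cubic expansion. -/
lemma coeff_zero {c0 c1 c2 c3 : ℂ}
    (h : (fun t : ℝ => c0 + c1 * (t : ℂ) + c2 * (t : ℂ) ^ 2 + c3 * (t : ℂ) ^ 3)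
      =o[𝓝 0] fun t : ℝ => t ^ 3) : c0 = 0 ∧ c1 = 0 ∧ c2 = 0 ∧ c3 = 0 := by
  have hne : ∀ᶠ t : ℝ in 𝓝[≠] 0, (t : ℂ) ≠ 0 := by
    filter_upwards [self_mem_nhdsWithin] with t ht
    exact_mod_cast ht
  have h3 : Tendsto (fun t : ℝ => (c0 + c1 * (t : ℂ) + c2 * (t : ℂ) ^ 2 + c3 * (t : ℂ) ^ 3)
      / (t : ℂ) ^ 3) (𝓝[≠] 0) (𝓝 0) := by
    have hb : (fun t : ℝ => t ^ 3) =O[𝓝 0] fun t : ℝ => (t : ℂ) ^ 3 :=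
      IsBigO.of_bound 1 (Eventually.of_forall fun t => by simp)
    exact ((h.trans_isBigO hb).mono nhdsWithin_le_nhds).tendsto_div_nhds_zero
  have hk : ∀ k : ℕ, Tendsto (fun t : ℝ => (t : ℂ) ^ k * ((c0 + c1 * (t : ℂ) + c2 * (t : ℂ) ^ 2
      + c3 * (t : ℂ) ^ 3) / (t : ℂ) ^ 3)) (𝓝[≠] 0) (𝓝 0) := by
    intro k
    have hc : Continuous (fun t : ℝ => (t : ℂ) ^ k) := by fun_prop
    simpa using ((hc.tendsto 0).mono_left nhdsWithin_le_nhds).mul h3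
  have lim : ∀ (c : ℂ) (p : ℝ → ℂ), Continuous p → p 0 = c → Tendsto p (𝓝[≠] 0) (𝓝 0) →
      c = 0 := by
    intro c p hp h0 ht
    have := (hp.tendsto 0).mono_left (nhdsWithin_le_nhds (s := {0}ᶜ))
    rw [← h0]
    exact tendsto_nhds_unique this ht
  have z0 : c0 = 0 := by
    refine lim c0 (fun t => c0 + c1 * (t : ℂ) + c2 * (t : ℂ) ^ 2 + c3 * (t : ℂ) ^ 3)
      (by fun_prop) (by simp) ((hk 3).congr' ?_)
    filter_upwards [hne] with t ht
    field_simp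
  have z1 : c1 = 0 := by
    refine lim c1 (fun t => c1 + c2 * (t : ℂ) + c3 * (t : ℂ) ^ 2)
      (by fun_prop) (by simp) ((hk 2).congr' ?_)
    filter_upwards [hne] with t ht
    rw [z0]
    field_simp
    ring
  have z2 : c2 = 0 := by
    refine lim c2 (fun t => c2 + c3 * (t : ℂ))
      (by fun_prop) (by simp) ((hk 1).congr' ?_)
    filter_upwards [hne] with t ht
    rw [z0, z1]
    field_simp
    ring
  have z3 : c3 = 0 := by
    refine lim c3 (fun t => c3)
      (by fun_prop) (by simp) ((hk 0).congr' ?_)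
    filter_upwards [hne] with t ht
    rw [z0, z1, z2]
    field_simp
    ring
  exact ⟨z0, z1, z2, z3⟩

lemma quad_expand {γ : ℝ → ℂ} {ψ : ℝ → E} {g0 g1 g2 g3 : ℂ} {a0 a1 a2 a3 : E}
    (hγ : (fun t : ℝ => γ t - (g0 + (t : ℂ) * g1 + (t : ℂ) ^ 2 * g2 + (t : ℂ) ^ 3 * g3))
      =o[𝓝 0] fun t : ℝ => t ^ 3)
    (hψ : (fun t : ℝ => ψ t - (a0 + (t : ℂ) • a1 + ((t : ℂ) ^ 2) • a2 + ((t : ℂ) ^ 3) • a3))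
      =o[𝓝 0] fun t : ℝ => t ^ 3) :
    (fun t : ℝ => (((γ t).im - ‖ψ t‖ ^ 2 : ℝ) : ℂ)
      - (((g0 - (starRingEnd ℂ) g0) / (2 * Complex.I) - (inner ℂ a0 a0))
       + ((g1 - (starRingEnd ℂ) g1) / (2 * Complex.I) - ((inner ℂ a0 a1) + (inner ℂ a1 a0))) * (t : ℂ)
       + ((g2 - (starRingEnd ℂ) g2) / (2 * Complex.I) - ((inner ℂ a0 a2) + (inner ℂ a1 a1) + (inner ℂ a2 a0)))
          * (t : ℂ) ^ 2
       + ((g3 - (starRingEnd ℂ) g3) / (2 * Complex.I)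
          - ((inner ℂ a0 a3) + (inner ℂ a1 a2) + (inner ℂ a2 a1) + (inner ℂ a3 a0))) * (t : ℂ) ^ 3))
      =o[𝓝 0] fun t : ℝ => t ^ 3 := by
  set T : ℝ → E := fun t => a0 + (t : ℂ) • a1 + ((t : ℂ) ^ 2) • a2 + ((t : ℂ) ^ 3) • a3 with hT
  set S : ℝ → ℂ := fun t => g0 + (t : ℂ) * g1 + (t : ℂ) ^ 2 * g2 + (t : ℂ) ^ 3 * g3 with hS
  have hTc : Continuous T := by fun_prop
  have hTb : T =O[𝓝 0] fun _ => (1 : ℝ) := (hTc.tendsto 0).isBigO_one ℝ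
  have h30 : (fun t : ℝ => t ^ 3) =O[𝓝 0] fun _ => (1 : ℝ) :=
    ((continuous_pow 3).tendsto (0 : ℝ)).isBigO_one ℝ
  have hψb : ψ =O[𝓝 0] fun _ => (1 : ℝ) := by
    have := (hψ.isBigO.trans h30).add hTb
    exact this.congr_left fun t => sub_add_cancel (ψ t) (T t)
  have in1 : (fun t => (inner ℂ (ψ t - T t) (ψ t))) =o[𝓝 0] fun t : ℝ => t ^ 3 := by
    have h1 : (fun t => (inner ℂ (ψ t - T t) (ψ t))) =O[𝓝 0] fun t => ‖ψ t - T t‖ * ‖ψ t‖ :=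
      IsBigO.of_bound 1 (Eventually.of_forall fun t => by
        rw [one_mul, Real.norm_of_nonneg (by positivity)]
        exact norm_inner_le_norm (𝕜 := ℂ) (ψ t - T t) (ψ t))
    simpa using h1.trans_isLittleO (hψ.norm_left.mul_isBigO hψb.norm_left)
  have in2 : (fun t => (inner ℂ (T t) (ψ t - T t))) =o[𝓝 0] fun t : ℝ => t ^ 3 := by
    have h1 : (fun t => (inner ℂ (T t) (ψ t - T t))) =O[𝓝 0] fun t => ‖ψ t - T t‖ * ‖T t‖ :=
      IsBigO.of_bound 1 (Eventually.of_forall fun t => by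
        rw [one_mul, Real.norm_of_nonneg (by positivity), mul_comm]
        exact norm_inner_le_norm (𝕜 := ℂ) (T t) (ψ t - T t))
    simpa using h1.trans_isLittleO (hψ.norm_left.mul_isBigO hTb.norm_left)
  have im1 : (fun t => (((γ t - S t).im : ℝ) : ℂ)) =o[𝓝 0] fun t : ℝ => t ^ 3 := by
    have h1 : (fun t => (((γ t - S t).im : ℝ) : ℂ)) =O[𝓝 0] fun t => γ t - S t :=
      IsBigO.of_bound 1 (Eventually.of_forall fun t => by
        rw [one_mul, Complex.norm_real]
        exact Complex.abs_im_le_norm (γ t - S t))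
    exact h1.trans_isLittleO hγ
  let R : ℝ → ℂ := fun t => ((inner ℂ a1 a3) + (inner ℂ a2 a2) + (inner ℂ a3 a1)) + ((inner ℂ a2 a3) + (inner ℂ a3 a2)) * (t : ℂ)
    + (inner ℂ a3 a3) * (t : ℂ) ^ 2
  have hR := rem_isLittleO (R := R) (by fun_prop)
  refine ((im1.sub (in1.add in2)).sub hR).congr_left fun t => ?_
  have e1 : ((‖ψ t‖ : ℂ)) ^ 2 = (inner ℂ (ψ t) (ψ t)) := (inner_self_eq_norm_sq_to_K (ψ t)).symm
  have e2 : ((S t).im : ℂ) = (S t - (starRingEnd ℂ) (S t)) / (2 * Complex.I) :=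
    Complex.im_eq_sub_conj (S t)
  have e3 : (inner ℂ (T t) (T t)) = (inner ℂ a0 a0) + ((inner ℂ a0 a1) + (inner ℂ a1 a0)) * (t : ℂ)
      + ((inner ℂ a0 a2) + (inner ℂ a1 a1) + (inner ℂ a2 a0)) * (t : ℂ) ^ 2
      + ((inner ℂ a0 a3) + (inner ℂ a1 a2) + (inner ℂ a2 a1) + (inner ℂ a3 a0)) * (t : ℂ) ^ 3 + (t : ℂ) ^ 4 * R t := by
    simp only [hT, R, inner_add_left, inner_add_right, inner_smul_left, inner_smul_right,
      map_pow, Complex.conj_ofReal]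
    ring
  have e4 : (starRingEnd ℂ) (S t) = (starRingEnd ℂ) g0 + t * (starRingEnd ℂ) g1
      + t ^ 2 * (starRingEnd ℂ) g2 + t ^ 3 * (starRingEnd ℂ) g3 := by
    simp [hS]
  push_cast
  rw [Complex.sub_im]
  push_cast
  rw [e1, e2, e4, inner_sub_left, inner_sub_right, e3]
  simp only [hS]
  ring

/-- The abstract one-variable version of the statement. -/
lemma one_var {G : ℂ → ℂ} {Φ : ℂ → E} {g0 g1 g2 g3 : ℂ} {a0 a1 a2 a3 : E}
    (hG : (fun s : ℂ => G s - (g0 + s • g1 + (s ^ 2 / 2) • g2 + (s ^ 3 / 6) • g3))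
      =o[𝓝 0] fun s : ℂ => s ^ 3)
    (hΦ : (fun s : ℂ => Φ s - (a0 + s • a1 + (s ^ 2 / 2) • a2 + (s ^ 3 / 6) • a3))
      =o[𝓝 0] fun s : ℂ => s ^ 3)
    (hb : ∀ᶠ t : ℝ in 𝓝 0, (G t).im = ‖Φ t‖ ^ 2) :
    (fun t : ℝ => (((G (Complex.I * t)).im - ‖Φ (Complex.I * t)‖ ^ 2 : ℝ) : ℂ)
      - ((g1 - 2 * Complex.I * (inner ℂ a0 a1)) * (t : ℂ) + (-2 * (inner ℂ a1 a1)) * (t : ℂ) ^ 2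
        + ((1 / 3 : ℂ) * (-(1 / 2 : ℂ) * g3 + 3 * Complex.I * (inner ℂ a2 a1)
          + Complex.I * (inner ℂ a0 a3))) * (t : ℂ) ^ 3)) =o[𝓝 0] fun t : ℝ => t ^ 3 := by
  have T : ∀ l : ℂ, Tendsto (fun t : ℝ => l * (t : ℂ)) (𝓝 0) (𝓝 0) := fun l => by
    have : Continuous (fun t : ℝ => l * (t : ℂ)) := by fun_prop
    simpa using this.tendsto 0
  have B : ∀ l : ℂ, (fun t : ℝ => (l * (t : ℂ)) ^ 3) =O[𝓝 0] fun t : ℝ => t ^ 3 := fun l =>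
    IsBigO.of_bound (‖l‖ ^ 3) (Eventually.of_forall fun t => by simp [mul_pow])
  have Q := fun l : ℂ => quad_expand (γ := fun t : ℝ => G (l * t)) (ψ := fun t : ℝ => Φ (l * t))
    (g0 := g0) (g1 := l * g1) (g2 := l ^ 2 / 2 * g2) (g3 := l ^ 3 / 6 * g3)
    (a0 := a0) (a1 := l • a1) (a2 := (l ^ 2 / 2) • a2) (a3 := (l ^ 3 / 6) • a3)
    (((hG.comp_tendsto (T l)).trans_isBigO (B l)).congr_left fun t => by
      simp only [Function.comp, smul_eq_mul]; ring)
    (((hΦ.comp_tendsto (T l)).trans_isBigO (B l)).congr_left fun t => by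
      simp only [Function.comp]; module)
  have Q1 := Q 1
  have Z := coeff_zero (Q1.neg_left.congr' (by
    filter_upwards [hb] with t ht
    simp only [one_mul, ht, sub_self, Complex.ofReal_zero, zero_sub, neg_neg]
    rfl) EventuallyEq.rfl)
  obtain ⟨z0, z1, z2, z3⟩ := Z
  have hI : Complex.I ≠ 0 := Complex.I_ne_zero
  have hI2 : Complex.I ^ 2 = -1 := Complex.I_sq
  have hI3 : Complex.I ^ 3 = -Complex.I := by rw [pow_succ, Complex.I_sq]; ring
  simp only [inner_smul_left, inner_smul_right, map_mul, map_div₀, map_one, map_ofNat,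
    one_pow, one_mul] at z0 z1 z2 z3
  refine (Q Complex.I).congr_left fun t => ?_
  simp only [inner_smul_left, inner_smul_right, map_mul, map_div₀, map_pow, map_ofNat,
    Complex.conj_I]
  have k0 : (starRingEnd ℂ) g0 = g0 - 2 * Complex.I * (inner ℂ a0 a0) := by
    field_simp at z0; linear_combination -z0
  have k1 : (starRingEnd ℂ) g1 = g1 - 2 * Complex.I * ((inner ℂ a0 a1) + (inner ℂ a1 a0)) := by
    field_simp at z1; linear_combination -z1
  have k2 : (starRingEnd ℂ) g2 = g2 - 2 * Complex.I * ((inner ℂ a0 a2) + 2 * (inner ℂ a1 a1) + (inner ℂ a2 a0)) := by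
    field_simp at z2; linear_combination -z2
  have k3 : (starRingEnd ℂ) g3 = g3 - 2 * Complex.I * ((inner ℂ a0 a3) + 3 * (inner ℂ a1 a2) + 3 * (inner ℂ a2 a1)
      + (inner ℂ a3 a0)) := by
    field_simp at z3; linear_combination -z3
  rw [k0, k1, k2, k3]
  congr 1
  have hdiv : ∀ x : ℂ, x / (2 * Complex.I) = -Complex.I / 2 * x := fun x => by
    field_simp; rw [hI2]; ring
  simp only [hdiv]
  generalize ((inner ℂ a0 a0) : ℂ) = x00
  generalize ((inner ℂ a0 a1) : ℂ) = x01
  generalize ((inner ℂ a1 a0) : ℂ) = x10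
  generalize ((inner ℂ a1 a1) : ℂ) = x11
  generalize ((inner ℂ a0 a2) : ℂ) = x02
  generalize ((inner ℂ a2 a0) : ℂ) = x20
  generalize ((inner ℂ a1 a2) : ℂ) = x12
  generalize ((inner ℂ a2 a1) : ℂ) = x21
  generalize ((inner ℂ a0 a3) : ℂ) = x03
  generalize ((inner ℂ a3 a0) : ℂ) = x30
  have hI4 : Complex.I ^ 4 = 1 := by rw [show (4:ℕ) = 2 * 2 from rfl, pow_mul, hI2]; norm_num
  have hI5 : Complex.I ^ 5 = Complex.I := by rw [pow_succ, hI4, one_mul]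
  ring_nf
  simp only [hI2, hI3, hI4, hI5]
  ring

end aux2

/-- Lemma 2.4: let `F = (f̃, g)` be holomorphic near `0 ∈ ℂ^{n−1} × ℂ`,
mapping `∂ℍ^n` into `∂ℍ^N`.  With `H(z,u,t) = Im g(z, u+i(t+‖z‖²)) − ‖f̃(z, u+i(t+‖z‖²))‖²`,
for `(z,u)` near `0` one has `H = P₁ t + P₂ t² + P₃ t³ + o(t³)` as `t → 0`, where, with
all derivatives evaluated at the boundary point `(z, u + i‖z‖²)`:
`P₁ = g_w − 2i (f̃_w · conj f̃)`, `P₂ = −2‖f̃_w‖²`,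
`P₃ = (1/3)(−(1/2) g_www + 3i (f̃_w · conj f̃_ww) + i (f̃_www · conj f̃))`. -/
theorem boundary_expansion_H {m k : ℕ}
    (V : Set (EuclideanSpace ℂ (Fin m) × ℂ)) (hVopen : IsOpen V)
    (h0V : (0 : EuclideanSpace ℂ (Fin m) × ℂ) ∈ V)
    (f : EuclideanSpace ℂ (Fin m) × ℂ → EuclideanSpace ℂ (Fin k))
    (g : EuclideanSpace ℂ (Fin m) × ℂ → ℂ)
    (hf : DifferentiableOn ℂ f V) (hg : DifferentiableOn ℂ g V)
    (hbdry : ∀ p ∈ V, p.2.im = ‖p.1‖ ^ 2 → (g p).im = ‖f p‖ ^ 2) :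
    ∃ ε > (0 : ℝ), ∀ (z : EuclideanSpace ℂ (Fin m)) (u : ℝ), ‖z‖ < ε → |u| < ε →
      let q : EuclideanSpace ℂ (Fin m) × ℂ :=
        (z, (u : ℂ) + Complex.I * ((‖z‖ ^ 2 : ℝ) : ℂ))
      let H : ℝ → ℝ := fun t =>
        (g (z, (u : ℂ) + Complex.I * ((t : ℂ) + ((‖z‖ ^ 2 : ℝ) : ℂ)))).im
          - ‖f (z, (u : ℂ) + Complex.I * ((t : ℂ) + ((‖z‖ ^ 2 : ℝ) : ℂ)))‖ ^ 2
      let P1 : ℂ := DW g q - 2 * Complex.I * ∑ j, DW f q j * (starRingEnd ℂ) (f q j)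
      let P2 : ℂ := ((-2 * ‖DW f q‖ ^ 2 : ℝ) : ℂ)
      let P3 : ℂ := (1 / 3 : ℂ) * (-(1 / 2 : ℂ) * DW (DW (DW g)) q
        + 3 * Complex.I * ∑ j, DW f q j * (starRingEnd ℂ) (DW (DW f) q j)
        + Complex.I * ∑ j, DW (DW (DW f)) q j * (starRingEnd ℂ) (f q j))
      (fun t : ℝ =>
          ((H t : ℝ) : ℂ) - (P1 * (t : ℂ) + P2 * (t : ℂ) ^ 2 + P3 * (t : ℂ) ^ 3))
        =o[nhds (0 : ℝ)] (fun t : ℝ => t ^ 3) := by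
  -- continuity of the base point map
  let Q : EuclideanSpace ℂ (Fin m) × ℝ → EuclideanSpace ℂ (Fin m) × ℂ := fun x =>
    (x.1, (x.2 : ℂ) + Complex.I * ((‖x.1‖ ^ 2 : ℝ) : ℂ))
  have hQ : Continuous Q := by fun_prop
  have hQ0 : ∀ᶠ x in 𝓝 (0 : EuclideanSpace ℂ (Fin m) × ℝ), Q x ∈ V := by
    apply hQ.continuousAt
    have : Q 0 = 0 := by ext <;> simp [Q]
    rw [this]
    exact hVopen.mem_nhds h0V
  obtain ⟨ε, hε, hball⟩ := eventually_nhds_iff_ball.mp hQ0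
  refine ⟨ε, hε, fun z u hz hu => ?_⟩
  intro q H P1 P2 P3
  have hq : q ∈ V := hball (z, u) (by
    rw [mem_ball_zero_iff, Prod.norm_def]
    exact max_lt hz hu)
  have hreal : ∀ᶠ t : ℝ in 𝓝 0,
      (g (q + (0, (t : ℂ)))).im = ‖f (q + (0, (t : ℂ)))‖ ^ 2 := by
    have hc : Continuous (fun t : ℝ => q + ((0 : EuclideanSpace ℂ (Fin m)), (t : ℂ))) := by
      fun_prop
    have he : q + ((0 : EuclideanSpace ℂ (Fin m)), ((0 : ℝ) : ℂ)) = q := by ext <;> simp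
    have hev : ∀ᶠ t : ℝ in 𝓝 0, q + (0, (t : ℂ)) ∈ V :=
      hc.continuousAt (by rw [he]; exact hVopen.mem_nhds hq)
    filter_upwards [hev] with t ht
    apply hbdry _ ht
    simp [q, -Complex.ofReal_pow]
  have key := one_var (taylor3 hVopen hg hq) (taylor3 hVopen hf hq) hreal
  have hin : ∀ x y : EuclideanSpace ℂ (Fin k),
      inner ℂ x y = ∑ j, y j * (starRingEnd ℂ) (x j) := fun x y => by
    simp [PiLp.inner_apply]
  have hP2 : P2 = -2 * inner ℂ (DW f q) (DW f q) := by
    rw [inner_self_eq_norm_sq_to_K]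
    simp [P2]
  have hpt : ∀ t : ℝ, q + ((0 : EuclideanSpace ℂ (Fin m)), Complex.I * (t : ℂ))
      = (z, (u : ℂ) + Complex.I * ((t : ℂ) + ((‖z‖ ^ 2 : ℝ) : ℂ))) := fun t => by
    simp only [q, Prod.mk_add_mk, add_zero]
    congr 1
    ring
  refine key.congr_left fun t => ?_
  rw [hP2, hin (f q) (DW f q), hin (DW (DW f) q), hin (f q) (DW (DW (DW f)) q), hpt t]
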